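/- arXiv:1609.03041 — 2 statements merged into one kernel-verified Lean document; each statement's English description precedes it below -/
import Mathlib

section
/- Suppose |V| = |R × S| and K_1 is invertible, and let r_p = (C_p/μ_p)·[1 − (2ν_p/C_p)(√(1 + C_p/ν_p) − 1)]. Let D be a compact subset of Ω_p = {φ ∈ ℂ^{R×S} : ‖φ‖_{ℓ^p} < r_p}. Then there exists a constant M = M(D, p) < ∞ such that for all φ_1, φ_2 ∈ D, if ψ_1 and ψ_2 denote the sums of the inverse Born series Σ_{j=1}^∞ 𝒦_j(φ_i, …, φ_i) (i = 1, 2), then ‖ψ_1 − ψ_2‖_{ℓ^p} ≤ M ‖φ_1 − φ_2‖_{ℓ^p}. -/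
open scoped ENNReal

/-- The ℓ^p norm of a finitely indexed family, `p ∈ [1, ∞]`. -/
noncomputable def lpNorm (p : ℝ≥0∞) {ι E : Type*} [Fintype ι] [SeminormedAddCommGroup E]
    (f : ι → E) : ℝ :=
  if p = ∞ then ⨆ i, ‖f i‖ else (∑ i, ‖f i‖ ^ p.toReal) ^ (1 / p.toReal)

variable {V R S : Type*} [Fintype V] [DecidableEq V] [Fintype R] [Fintype S]

/-- The multilinear forward Born operator: `bornK α0 B G C j` is `K_j`, mapping
`(η_1, …, η_j)` (given as the first `j` values of an `ℕ`-indexed family) to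
`(r, s) ↦ (−α0)^j (B D_{η_1} G D_{η_2} G ⋯ G D_{η_j} C)(r, s)`; `K_0 := 0` is junk. -/
noncomputable def bornK (α0 : ℝ) (B : Matrix R V ℂ) (G : Matrix V V ℂ) (C : Matrix V S ℂ) :
    ℕ → (ℕ → V → ℂ) → R × S → ℂ
  | 0, _ => 0
  | j + 1, η => fun rs =>
      (-(α0 : ℂ)) ^ (j + 1) *
        (B * Matrix.diagonal (η 0) *
          (List.ofFn fun i : Fin j => G * Matrix.diagonal (η (i.1 + 1))).prod * C) rs.1 rs.2

/-- `μ_p = α0 · max_{v ∈ V} ‖row v of G‖_{ℓ^q}` (this depends only on `q`). -/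
noncomputable def muConst (α0 : ℝ) (q : ℝ≥0∞) (G : Matrix V V ℂ) : ℝ :=
  α0 * ⨆ v : V, lpNorm q (G v)

/-- `ν_p = α0 · (Σ_{r ∈ R} ‖row r of B‖_q^p)^{1/p} · (Σ_{s ∈ S} ‖column s of C‖_q^p)^{1/p}`,
with maxima replacing sums when `p = ∞`. -/
noncomputable def nuConst (α0 : ℝ) (p q : ℝ≥0∞) (B : Matrix R V ℂ) (C : Matrix V S ℂ) : ℝ :=
  α0 * lpNorm p (fun r : R => lpNorm q (B r)) * lpNorm p (fun s : S => lpNorm q fun v => C v s)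

/-- `C_p = min_{‖η‖_p = 1} ‖K_1 η‖_p`. -/
noncomputable def CpConst (p : ℝ≥0∞) (α0 : ℝ) (B : Matrix R V ℂ) (G : Matrix V V ℂ)
    (C : Matrix V S ℂ) : ℝ :=
  sInf {t : ℝ | ∃ η : V → ℂ, lpNorm p η = 1 ∧ t = lpNorm p (bornK α0 B G C 1 fun _ => η)}

/-- Block application for the tensor sum over compositions: given a composition `c` of `j`
and arguments `x : (ℂ^V)^j` (as an `ℕ`-indexed family), `blockK c x` is the `m`-tuple
`(K_{i_1} ⊗ ⋯ ⊗ K_{i_m})(x_1, …, x_j)`, where `m = c.length`, `i_k = c.blocksFun k`, and the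
`k`-th component applies `K_{i_k}` to the consecutive block of arguments of size `i_k`. -/
noncomputable def blockK (α0 : ℝ) (B : Matrix R V ℂ) (G : Matrix V V ℂ) (C : Matrix V S ℂ)
    {j : ℕ} (c : Composition j) (x : ℕ → V → ℂ) : ℕ → R × S → ℂ :=
  fun k =>
    if h : k < c.length then
      bornK α0 B G C (c.blocksFun ⟨k, h⟩) (fun i => x (c.sizeUpTo k + i))
    else 0

/-- The multilinear inverse Born operators: `bornKinv α0 B G C 𝒦₁ j` is `𝒦_j`, where
`𝒦_1 = 𝒦₁` (intended to be `K_1⁻¹`) and, for `j ≥ 2`,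
`𝒦_j = −(Σ_{m=1}^{j−1} 𝒦_m ∘ (Σ_{i_1+⋯+i_m=j, i_k ≥ 1} K_{i_1} ⊗ ⋯ ⊗ K_{i_m})) ∘ (𝒦_1 ⊗ ⋯ ⊗ 𝒦_1)`;
the inner sum over `m` and over `(i_1, …, i_m)` is the sum over all compositions `c` of `j`
with `c.length = m < j`. `𝒦_0 := 0` is junk. -/
noncomputable def bornKinv (α0 : ℝ) (B : Matrix R V ℂ) (G : Matrix V V ℂ) (C : Matrix V S ℂ)
    (K1inv : (R × S → ℂ) → V → ℂ) : ℕ → (ℕ → R × S → ℂ) → V → ℂ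
  | 0 => fun _ => 0
  | 1 => fun x => K1inv (x 0)
  | j + 2 => fun x =>
      -∑ c : Composition (j + 2),
        if h : c.length < j + 2 then
          bornKinv α0 B G C K1inv c.length (blockK α0 B G C c fun i => K1inv (x i))
        else 0
  termination_by j => j
  decreasing_by exact h

/-- The multilinear operator norm `‖T‖_p` of a `j`-multilinear map `T` (taking its arguments
as an `ℕ`-indexed family, only the first `j` of which matter): the smallest constant `t` with
`‖T(x_1, …, x_j)‖_p ≤ t ∏_{i=1}^j ‖x_i‖_p` for all `x`. -/
noncomputable def mulNorm (p : ℝ≥0∞) (j : ℕ) (T : (ℕ → R × S → ℂ) → V → ℂ) : ℝ :=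
  sInf {t : ℝ | ∀ x : ℕ → R × S → ℂ, lpNorm p (T x) ≤ t * ∏ i ∈ Finset.range j, lpNorm p (x i)}

theorem ibs_norm {ι E : Type*} [Fintype ι] [SeminormedAddCommGroup E] (p : ℝ≥0∞) [Fact (1 ≤ p)]
    (f : ι → E) : lpNorm p f = ‖WithLp.toLp p f‖ := by
  unfold lpNorm
  split_ifs with h
  · subst h; rw [PiLp.norm_eq_ciSup]
  · rw [PiLp.norm_eq_sum (ENNReal.toReal_pos (by
      have := Fact.out (p := 1 ≤ p); positivity) h)]

theorem ibs_nonneg {ι E : Type*} [Fintype ι] [SeminormedAddCommGroup E] (p : ℝ≥0∞)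
    (hp : 1 ≤ p) (f : ι → E) : 0 ≤ lpNorm p f := by
  have : Fact (1 ≤ p) := ⟨hp⟩
  rw [ibs_norm]; exact norm_nonneg _

theorem ibs_apply_le {ι E : Type*} [Fintype ι] [SeminormedAddCommGroup E] (p : ℝ≥0∞)
    (hp : 1 ≤ p) (f : ι → E) (i : ι) : ‖f i‖ ≤ lpNorm p f := by
  have : Fact (1 ≤ p) := ⟨hp⟩
  rw [ibs_norm]; exact PiLp.norm_apply_le (WithLp.toLp p f) i

theorem ibs_mono {ι E F : Type*} [Fintype ι] [SeminormedAddCommGroup E] [SeminormedAddCommGroup F]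
    (p : ℝ≥0∞) (hp : 1 ≤ p) (f : ι → E) (g : ι → F) (h : ∀ i, ‖f i‖ ≤ ‖g i‖) :
    lpNorm p f ≤ lpNorm p g := by
  unfold lpNorm
  split_ifs with hpt
  · rcases isEmpty_or_nonempty ι with hι | hι
    · simp
    · exact ciSup_mono (Set.finite_range _).bddAbove h
  · gcongr with i
    exact h i

theorem ibs_l1_le {ι E F : Type*} [Fintype ι] [SeminormedAddCommGroup E]
    [SeminormedAddCommGroup F] (f : ι → E) (g : ι → F) :
    ∑ i, ‖f i‖ * ‖g i‖ ≤ lpNorm 1 f * lpNorm ∞ g := by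
  have : lpNorm 1 f = ∑ i, ‖f i‖ := by simp [lpNorm]
  rw [this, Finset.sum_mul]
  gcongr with i
  exact ibs_apply_le ∞ le_top g i

theorem ibs_holder {ι E F : Type*} [Fintype ι] [SeminormedAddCommGroup E]
    [SeminormedAddCommGroup F] (p q : ℝ≥0∞) (hp : 1 ≤ p) (hq : 1 ≤ q) (hpq : 1 / p + 1 / q = 1)
    (f : ι → E) (g : ι → F) :
    ∑ i, ‖f i‖ * ‖g i‖ ≤ lpNorm q f * lpNorm p g := by
  by_cases hp1 : p = ∞
  · subst hp1
    have : q = 1 := by simpa using hpq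
    subst this
    exact ibs_l1_le f g
  by_cases hq1 : q = ∞
  · subst hq1
    have : p = 1 := by simpa using hpq
    subst this
    have := ibs_l1_le g f
    simpa only [mul_comm] using this
  have h : q.toReal.HolderConjugate p.toReal := by
    have h0 : ENNReal.HolderConjugate q p := by
      constructor
      simpa [add_comm] using hpq
    exact ENNReal.HolderConjugate.toReal_of_ne_top hq1 hp1
  have := Real.inner_le_Lp_mul_Lq Finset.univ (fun i => ‖f i‖) (fun i => ‖g i‖) h
  simpa [lpNorm, hp1, hq1] using this

theorem ibs_prod {ι κ : Type*} [Fintype ι] [Fintype κ] [Nonempty ι] [Nonempty κ]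
    (p : ℝ≥0∞) (hp : 1 ≤ p) (f : ι → ℝ) (g : κ → ℝ) :
    lpNorm p (fun x : ι × κ => f x.1 * g x.2) ≤ lpNorm p f * lpNorm p g := by
  by_cases h : p = ∞
  · have : lpNorm p (fun x : ι × κ => f x.1 * g x.2) = ⨆ x : ι × κ, ‖f x.1 * g x.2‖ := by
      simp [lpNorm, h]
    rw [this]
    refine ciSup_le fun x => ?_
    rw [norm_mul]
    have h1 := ibs_apply_le p hp f x.1
    have h2 := ibs_apply_le p hp g x.2
    have := ibs_nonneg p hp f
    gcongr
  · simp only [lpNorm, h, if_false, norm_mul]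
    rw [← Real.mul_rpow (by positivity) (by positivity), Fintype.sum_prod_type,
      Finset.sum_mul_sum]
    simp only [Real.mul_rpow (norm_nonneg _) (norm_nonneg _)]
    exact le_rfl

theorem ibs_const_mul {ι : Type*} [Fintype ι] (p : ℝ≥0∞) (hp : 1 ≤ p) (c : ℝ) (hc : 0 ≤ c)
    (f : ι → ℝ) : lpNorm p (fun x => c * f x) = c * lpNorm p f := by
  have : Fact (1 ≤ p) := ⟨hp⟩
  have : (WithLp.toLp p fun x => c * f x) = c • WithLp.toLp p f := rfl
  rw [ibs_norm, ibs_norm, this, norm_smul, Real.norm_of_nonneg hc]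

theorem ibs_chain (p q : ℝ≥0∞) (hp : 1 ≤ p) (hq : 1 ≤ q) (hpq : 1 / p + 1 / q = 1)
    (G : Matrix V V ℂ) (m : ℝ) (hm : ∀ v, lpNorm q (G v) ≤ m) (hm0 : 0 ≤ m) (j : ℕ) :
    ∀ (η : Fin j → V → ℂ) (x : V → ℂ),
    ∑ v, ‖Matrix.vecMul x (List.ofFn fun i : Fin j => G * Matrix.diagonal (η i)).prod v‖ ≤
      (∑ v, ‖x v‖) * (m ^ j * ∏ i, lpNorm p (η i)) := by
  induction j with
  | zero => intro η x; simp
  | succ j ih =>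
    intro η x
    rw [List.ofFn_succ, List.prod_cons, ← Matrix.vecMul_vecMul]
    refine (ih (fun i => η i.succ) _).trans ?_
    rw [Fin.prod_univ_succ, pow_succ]
    have h0 : ∀ i, 0 ≤ lpNorm p (η i) := fun i => ibs_nonneg p hp _
    have key : ∑ w, ‖Matrix.vecMul x (G * Matrix.diagonal (η 0)) w‖ ≤
        (∑ v, ‖x v‖) * (m * lpNorm p (η 0)) := by
      calc ∑ w, ‖Matrix.vecMul x (G * Matrix.diagonal (η 0)) w‖
          ≤ ∑ w, ∑ v, ‖x v‖ * (‖G v w‖ * ‖η 0 w‖) := by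
            gcongr with w
            simp only [Matrix.vecMul, dotProduct, Matrix.mul_diagonal]
            refine (norm_sum_le _ _).trans ?_
            simp only [norm_mul]
            exact le_rfl
        _ = ∑ v, ‖x v‖ * ∑ w, ‖G v w‖ * ‖η 0 w‖ := by
            rw [Finset.sum_comm]; simp only [Finset.mul_sum]
        _ ≤ ∑ v, ‖x v‖ * (m * lpNorm p (η 0)) := by
            gcongr with v
            refine (ibs_holder p q hp hq hpq _ _).trans ?_
            have := h0 0
            gcongr
            exact hm v
        _ = _ := by rw [Finset.sum_mul]
    have h1 : 0 ≤ ∏ i : Fin j, lpNorm p (η i.succ) := Finset.prod_nonneg fun i _ => h0 _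
    calc _ ≤ (∑ v, ‖x v‖) * (m * lpNorm p (η 0)) * (m ^ j * ∏ i : Fin j, lpNorm p (η i.succ)) := by
          gcongr
      _ = _ := by ring

set_option maxHeartbeats 2000000 in
theorem ibs_bound [Nonempty V] [Nonempty R] [Nonempty S]
    (p q : ℝ≥0∞) (hp : 1 ≤ p) (hq : 1 ≤ q) (hpq : 1 / p + 1 / q = 1)
    (α0 : ℝ) (hα0 : 0 < α0) (B : Matrix R V ℂ) (G : Matrix V V ℂ) (C : Matrix V S ℂ)
    (j : ℕ) (η : ℕ → V → ℂ) :
    lpNorm p (bornK α0 B G C (j + 1) η) ≤ nuConst α0 p q B C * muConst α0 q G ^ j *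
      ∏ i : Fin (j + 1), lpNorm p (η i) := by
  obtain ⟨m, hmdef⟩ : ∃ m, m = ⨆ v : V, lpNorm q (G v) := ⟨_, rfl⟩
  have hm : ∀ v, lpNorm q (G v) ≤ m := fun v => by
    rw [hmdef]; exact le_ciSup (f := fun v => lpNorm q (G v)) (Set.finite_range _).bddAbove v
  have hm0 : 0 ≤ m := (ibs_nonneg q hq _).trans (hm (Classical.arbitrary V))
  have h0 : ∀ i, 0 ≤ lpNorm p (η i) := fun i => ibs_nonneg p hp _
  have hP : 0 ≤ ∏ i : Fin j, lpNorm p (η (i + 1)) := Finset.prod_nonneg fun i _ => h0 _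
  have hent : ∀ rs : R × S, ‖bornK α0 B G C (j + 1) η rs‖ ≤
      (α0 ^ (j + 1) * (m ^ j * (lpNorm p (η 0) * ∏ i : Fin j, lpNorm p (η (i + 1))))) *
        (lpNorm q (B rs.1) * lpNorm q fun v => C v rs.2) := by
    rintro ⟨r, s⟩
    have e : (B * Matrix.diagonal (η 0) *
          (List.ofFn fun i : Fin j => G * Matrix.diagonal (η (i.1 + 1))).prod * C) r s =
        ∑ v, Matrix.vecMul ((B * Matrix.diagonal (η 0)) r)
          (List.ofFn fun i : Fin j => G * Matrix.diagonal (η (i.1 + 1))).prod v * C v s := by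
      rw [Matrix.mul_apply]; rfl
    have hC : ∀ v, ‖C v s‖ ≤ lpNorm q fun v => C v s := fun v =>
      ibs_apply_le q hq (fun v => C v s) v
    have hC0 : 0 ≤ lpNorm q fun v => C v s := ibs_nonneg q hq _
    have hB : ∑ v, ‖(B * Matrix.diagonal (η 0)) r v‖ ≤ lpNorm q (B r) * lpNorm p (η 0) := by
      simp only [Matrix.mul_diagonal, norm_mul]
      exact ibs_holder p q hp hq hpq _ _
    have hch := ibs_chain p q hp hq hpq G m hm hm0 j (fun i => η (i.1 + 1))
      ((B * Matrix.diagonal (η 0)) r)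
    simp only [bornK, norm_mul, norm_pow, norm_neg, Complex.norm_real, Real.norm_of_nonneg hα0.le]
    rw [e]
    calc _ ≤ α0 ^ (j + 1) * ∑ v, ‖Matrix.vecMul ((B * Matrix.diagonal (η 0)) r)
          (List.ofFn fun i : Fin j => G * Matrix.diagonal (η (i.1 + 1))).prod v‖ *
            lpNorm q fun v => C v s := by
          gcongr
          refine (norm_sum_le _ _).trans ?_
          gcongr with v
          rw [norm_mul]
          gcongr
          exact hC v
      _ ≤ α0 ^ (j + 1) * (((lpNorm q (B r) * lpNorm p (η 0)) *
            (m ^ j * ∏ i : Fin j, lpNorm p (η (i + 1)))) * lpNorm q fun v => C v s) := by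
          rw [← Finset.sum_mul]
          gcongr
          refine hch.trans ?_
          gcongr
      _ = _ := by ring
  have hc0 : 0 ≤ α0 ^ (j + 1) * (m ^ j * (lpNorm p (η 0) * ∏ i : Fin j, lpNorm p (η (i + 1)))) := by
    exact mul_nonneg (pow_nonneg hα0.le _) (mul_nonneg (pow_nonneg hm0 _) (mul_nonneg (h0 0) hP))
  calc _ ≤ lpNorm p (fun rs : R × S =>
        (α0 ^ (j + 1) * (m ^ j * (lpNorm p (η 0) * ∏ i : Fin j, lpNorm p (η (i + 1))))) *
        (lpNorm q (B rs.1) * lpNorm q fun v => C v rs.2)) :=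
        ibs_mono p hp _ _ fun rs => (hent rs).trans (le_abs_self _)
    _ ≤ (α0 ^ (j + 1) * (m ^ j * (lpNorm p (η 0) * ∏ i : Fin j, lpNorm p (η (i + 1))))) *
        (lpNorm p (fun r : R => lpNorm q (B r)) * lpNorm p (fun s : S => lpNorm q fun v => C v s)) := by
        rw [ibs_const_mul p hp _ hc0]
        gcongr
        exact ibs_prod p hp (fun r => lpNorm q (B r)) (fun s => lpNorm q fun v => C v s)
    _ = _ := by
        rw [Fin.prod_univ_succ, nuConst, muConst, ← hmdef]
        simp only [Fin.val_zero, Fin.val_succ]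
        ring
open Finset in
theorem ibs_radius {E F : Type*} [NormedAddCommGroup E] [NormedSpace ℂ E]
    [NormedAddCommGroup F] [NormedSpace ℂ F] (P : FormalMultilinearSeries ℂ E F)
    (i : E ≃L[ℂ] F) (mu nu Cp rp : ℝ) (hmu : 0 < mu) (hnu : 0 < nu) (hCp : 0 < Cp)
    (hrp0 : 0 < rp)
    (hrp : rp = Cp / mu * (1 - 2 * nu / Cp * (Real.sqrt (1 + Cp / nu) - 1)))
    (hP : ∀ n, ‖P n‖ ≤ nu / mu * mu ^ n)
    (hi : ‖(i.symm : F →L[ℂ] E)‖ ≤ 1 / Cp) :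
    ENNReal.ofReal rp ≤ (P.rightInv i 0).radius := by
  obtain ⟨w, hw⟩ : ∃ w, w = Real.sqrt (1 + Cp / nu) := ⟨_, rfl⟩
  have hw2 : w ^ 2 = 1 + Cp / nu := by rw [hw]; exact Real.sq_sqrt (by positivity)
  have hw1 : 1 < w := by
    have : 0 < Cp / nu := by positivity
    have hw0 : 0 ≤ w := hw ▸ Real.sqrt_nonneg _
    nlinarith
  have hCpw : Cp = nu * (w ^ 2 - 1) := by rw [hw2]; field_simp; ring
  have hrpw : rp = nu * (w - 1) ^ 2 / mu := by
    rw [hrp, ← hw]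
    field_simp
    rw [hCpw]; ring
  obtain ⟨Y, hY⟩ : ∃ Y, Y = (1 - 1 / w) / mu := ⟨_, rfl⟩
  have hYmu : mu * Y = 1 - 1 / w := by rw [hY]; field_simp
  have hinv : 1 / w < 1 := by rw [div_lt_one (by linarith)]; exact hw1
  have hinv0 : 0 < 1 / w := by positivity
  have hY0 : 0 < Y := by rw [hY]; apply div_pos <;> linarith
  have hbound : ∀ n : ℕ, ∑ k ∈ Ico 1 (n + 1), rp ^ k * ‖P.rightInv i 0 k‖ ≤ Y := by
    intro n
    induction n with
    | zero => simpa using hY0.le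
    | succ n ih =>
      refine (FormalMultilinearSeries.radius_rightInv_pos_of_radius_pos_aux2 (by omega) P i
        hmu.le hrp0.le (by positivity : 0 ≤ nu / mu) hP).trans ?_
      set T := ∑ j ∈ Ico 1 (n + 1), rp ^ j * ‖P.rightInv i 0 j‖ with hT
      have hT0 : 0 ≤ T := sum_nonneg fun j _ => by positivity
      have hx : mu * T ≤ 1 - 1 / w := by rw [← hYmu]; gcongr
      have hgeo : ∑ k ∈ Ico 2 (n + 1 + 1), (mu * T) ^ k ≤ (1 - 1 / w) ^ 2 / (1 - (1 - 1 / w)) := by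
        calc ∑ k ∈ Ico 2 (n + 1 + 1), (mu * T) ^ k
            ≤ ∑ k ∈ Ico 2 (n + 1 + 1), (1 - 1 / w) ^ k := by gcongr
          _ ≤ _ := geom_sum_Ico_le_of_lt_one (by linarith) (by linarith)
      have hI0 : 0 ≤ ‖(i.symm : F →L[ℂ] E)‖ := norm_nonneg _
      have hS0 : 0 ≤ ∑ k ∈ Ico 2 (n + 1 + 1), (mu * T) ^ k := sum_nonneg fun j _ => by positivity
      calc _ ≤ 1 / Cp * rp + 1 / Cp * (nu / mu) * ((1 - 1 / w) ^ 2 / (1 - (1 - 1 / w))) := by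
            gcongr
        _ = Y := by
            have h1 : w - 1 ≠ 0 := by linarith
            have h2 : w + 1 ≠ 0 := by linarith
            have h3 : w ≠ 0 := by linarith
            have h4 : w ^ 2 - 1 = (w - 1) * (w + 1) := by ring
            rw [hrpw, hCpw, hY, h4, sub_sub_cancel]
            field_simp
            try ring
  have := (P.rightInv i 0).le_radius_of_bound Y (r := ⟨rp, hrp0.le⟩) ?_
  · convert this using 1
    rw [ENNReal.ofReal, Real.toNNReal_of_nonneg hrp0.le]
    rfl
  · intro n
    rcases n with _ | n
    · simp; exact hY0.le
    · refine le_trans ?_ (hbound (n + 1))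
      rw [mul_comm]
      exact single_le_sum (f := fun k => rp ^ k * ‖P.rightInv i 0 k‖)
        (fun k _ => by positivity) (by simp)

theorem ibs_lip {E F : Type*} [NormedAddCommGroup E] [NormedSpace ℂ E] [CompleteSpace E]
    [NormedAddCommGroup F] [NormedSpace ℂ F] (Q : FormalMultilinearSeries ℂ F E)
    (rp : ℝ) (hrp0 : 0 < rp) (hQ : ENNReal.ofReal rp ≤ Q.radius) (D : Set F) (hD : IsCompact D)
    (hsub : ∀ x ∈ D, ‖x‖ < rp) : ∃ K, LipschitzOnWith K Q.sum D := by
  have h1 : HasFPowerSeriesOnBall Q.sum Q 0 (ENNReal.ofReal rp) :=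
    (Q.hasFPowerSeriesOnBall ((ENNReal.ofReal_pos.2 hrp0).trans_le hQ)).mono
      (ENNReal.ofReal_pos.2 hrp0) hQ
  have h2 := h1.analyticOnNhd
  rw [Metric.eball_ofReal] at h2
  have h3 : ContDiffOn ℂ 1 Q.sum (Metric.ball 0 rp) := h2.analyticOn.contDiffOn Metric.isOpen_ball.uniqueDiffOn
  let : NormedSpace ℝ E := NormedSpace.restrictScalars ℝ ℂ E
  let : NormedSpace ℝ F := NormedSpace.restrictScalars ℝ ℂ F
  have h4 : LocallyLipschitzOn (Metric.ball 0 rp) Q.sum :=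
    (h3.restrict_scalars ℝ).locallyLipschitzOn (convex_ball _ _)
  exact LocallyLipschitzOn.exists_lipschitzOnWith_of_compact hD
    (h4.mono fun x hx => by simpa using hsub x hx)
/-- The linear map `M ↦ (-α0)^n B M C`. -/
noncomputable def ibsLin (α0 : ℝ) (B : Matrix R V ℂ) (C : Matrix V S ℂ) (n : ℕ) :
    Matrix V V ℂ →ₗ[ℂ] (R × S → ℂ) where
  toFun M rs := (-(α0 : ℂ)) ^ n * (B * M * C) rs.1 rs.2
  map_add' M N := by
    ext rs
    simp [Matrix.mul_add, Matrix.add_mul, mul_add]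
  map_smul' c M := by
    ext rs
    simp [mul_left_comm]

/-- `K_n` as a multilinear map. -/
noncomputable def ibsMul (p : ℝ≥0∞) (α0 : ℝ) (B : Matrix R V ℂ) (G : Matrix V V ℂ)
    (C : Matrix V S ℂ) : (n : ℕ) →
    MultilinearMap ℂ (fun _ : Fin n => PiLp p (fun _ : V => ℂ)) (PiLp p (fun _ : R × S => ℂ))
  | 0 => 0
  | j + 1 =>
    ((WithLp.linearEquiv p ℂ (R × S → ℂ)).symm.toLinearMap ∘ₗ
      ibsLin α0 B C (j + 1)).compMultilinearMap
      ((MultilinearMap.mkPiAlgebraFin ℂ (j + 1) (Matrix V V ℂ)).compLinearMap fun i =>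
        (if i = 0 then LinearMap.id else LinearMap.mulLeft ℂ G) ∘ₗ
          Matrix.diagonalLinearMap V ℂ ℂ ∘ₗ (WithLp.linearEquiv p ℂ (V → ℂ)).toLinearMap)

theorem ibsMul_apply (p : ℝ≥0∞) (α0 : ℝ) (B : Matrix R V ℂ) (G : Matrix V V ℂ)
    (C : Matrix V S ℂ) (n : ℕ) (x : ℕ → PiLp p (fun _ : V => ℂ)) :
    ibsMul p α0 B G C n (fun i => x i) =
      WithLp.toLp p (bornK α0 B G C n fun k => WithLp.ofLp (x k)) := by
  cases n with
  | zero => simp only [ibsMul, bornK]; rfl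
  | succ j =>
    apply WithLp.ofLp_injective p
    ext rs
    simp [ibsMul, bornK, ibsLin, List.ofFn_succ, Matrix.mul_assoc, Fin.succ_ne_zero]

theorem ibsMul_continuous (p : ℝ≥0∞) [Fact (1 ≤ p)] (α0 : ℝ) (B : Matrix R V ℂ)
    (G : Matrix V V ℂ) (C : Matrix V S ℂ) (n : ℕ) : Continuous (ibsMul p α0 B G C n) := by
  cases n with
  | zero => exact continuous_const
  | succ j =>
    refine (LinearMap.continuous_of_finiteDimensional
      ((WithLp.linearEquiv p ℂ (R × S → ℂ)).symm.toLinearMap ∘ₗ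
        ibsLin α0 B C (j + 1))).comp ?_
    have h : Continuous fun m : Fin (j + 1) → PiLp p (fun _ : V => ℂ) =>
        ((List.finRange (j + 1)).map fun i =>
          ((if i = 0 then LinearMap.id else LinearMap.mulLeft ℂ G) ∘ₗ
          Matrix.diagonalLinearMap V ℂ ℂ ∘ₗ
            (WithLp.linearEquiv p ℂ (V → ℂ)).toLinearMap) (m i)).prod := by
      refine continuous_list_prod _ fun i _ => ?_
      exact (LinearMap.continuous_of_finiteDimensional
        ((if i = 0 then LinearMap.id else LinearMap.mulLeft ℂ G) ∘ₗ
          Matrix.diagonalLinearMap V ℂ ℂ ∘ₗ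
            (WithLp.linearEquiv p ℂ (V → ℂ)).toLinearMap)).comp (continuous_apply i)
    simp only [← List.ofFn_eq_map] at h
    exact h

/-- The forward Born series as a formal multilinear series. -/
noncomputable def ibsSeries (p : ℝ≥0∞) [Fact (1 ≤ p)] (α0 : ℝ) (B : Matrix R V ℂ)
    (G : Matrix V V ℂ) (C : Matrix V S ℂ) :
    FormalMultilinearSeries ℂ (PiLp p (fun _ : V => ℂ)) (PiLp p (fun _ : R × S => ℂ)) :=
  fun n => ⟨ibsMul p α0 B G C n, ibsMul_continuous p α0 B G C n⟩

theorem ibsSeries_apply (p : ℝ≥0∞) [Fact (1 ≤ p)] (α0 : ℝ) (B : Matrix R V ℂ) (G : Matrix V V ℂ)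
    (C : Matrix V S ℂ) (n : ℕ) (x : ℕ → PiLp p (fun _ : V => ℂ)) :
    ibsSeries p α0 B G C n (fun i => x i) =
      WithLp.toLp p (bornK α0 B G C n fun k => WithLp.ofLp (x k)) :=
  ibsMul_apply p α0 B G C n x

theorem ibsSeries_norm [Nonempty V] [Nonempty R] [Nonempty S]
    (p q : ℝ≥0∞) [Fact (1 ≤ p)] (hq : 1 ≤ q) (hpq : 1 / p + 1 / q = 1)
    (α0 : ℝ) (hα0 : 0 < α0) (B : Matrix R V ℂ) (G : Matrix V V ℂ) (C : Matrix V S ℂ)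
    (mu nu : ℝ) (hmu : mu = muConst α0 q G) (hnu : nu = nuConst α0 p q B C)
    (hmu0 : 0 < mu) (hnu0 : 0 ≤ nu) (n : ℕ) :
    ‖ibsSeries p α0 B G C n‖ ≤ nu / mu * mu ^ n := by
  have hp : 1 ≤ p := Fact.out
  refine ContinuousMultilinearMap.opNorm_le_bound (by positivity) fun m => ?_
  obtain ⟨x, rfl⟩ : ∃ x : ℕ → PiLp p (fun _ : V => ℂ), m = fun i : Fin n => x i :=
    ⟨fun k => if h : k < n then m ⟨k, h⟩ else 0, by ext i; simp⟩
  rw [ibsSeries_apply, ← ibs_norm]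
  cases n with
  | zero =>
    have : lpNorm p (bornK α0 B G C 0 fun k => WithLp.ofLp (x k)) = 0 := by
      rw [ibs_norm]; simp [bornK]
    rw [this]
    simp; positivity
  | succ j =>
    refine (ibs_bound p q hp hq hpq α0 hα0 B G C j _).trans (le_of_eq ?_)
    rw [← hmu, ← hnu, pow_succ]
    simp only [ibs_norm, WithLp.toLp_ofLp]
    field_simp

theorem ibs_leftInv (p : ℝ≥0∞) [Fact (1 ≤ p)] (α0 : ℝ) (B : Matrix R V ℂ) (G : Matrix V V ℂ)
    (C : Matrix V S ℂ) (K1inv : (R × S → ℂ) → V → ℂ)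
    (i : PiLp p (fun _ : V => ℂ) ≃L[ℂ] PiLp p (fun _ : R × S => ℂ))
    (hi : ∀ y, i.symm y = WithLp.toLp p (K1inv (WithLp.ofLp y))) (n : ℕ) :
    ∀ x : ℕ → PiLp p (fun _ : R × S => ℂ),
    (ibsSeries p α0 B G C).leftInv i 0 n (fun k => x k) =
      WithLp.toLp p (bornKinv α0 B G C K1inv n fun k => WithLp.ofLp (x k)) := by
  induction n using Nat.strong_induction_on with | _ n IH
  intro x
  match n with
  | 0 => simp [bornKinv]
  | 1 => simp [bornKinv, hi]
  | n + 2 =>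
    rw [FormalMultilinearSeries.leftInv, bornKinv]
    rw [WithLp.toLp_neg, WithLp.toLp_sum]
    simp only [neg_apply, sum_apply]
    congr 1
    rw [← Fintype.sum_subtype_add_sum_subtype (fun c : Composition (n + 2) => c.length < n + 2)]
    rw [Finset.sum_eq_zero (s := (Finset.univ : Finset {c : Composition (n + 2) //
      ¬ c.length < n + 2}))
      (fun c _ => by rw [dif_neg c.2]; rfl), add_zero]
    refine Finset.sum_congr rfl fun c _ => ?_
    rw [dif_pos c.2, ContinuousMultilinearMap.compAlongComposition_apply]
    rw [← IH _ c.2 (fun k => WithLp.toLp p (blockK α0 B G C c.1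
      (fun i => K1inv (WithLp.ofLp (x i))) k))]
    congr 1
    ext1 k
    simp only [FormalMultilinearSeries.applyComposition, blockK]
    rw [dif_pos k.2]
    have := ibsSeries_apply p α0 B G C (c.1.blocksFun k)
      (fun l => i.symm (x (c.1.sizeUpTo k + l)))
    simp only [hi] at this
    rw [← this]
    simp only [FormalMultilinearSeries.compContinuousLinearMap_apply]
    congr 1
    ext1 l
    simp [hi]
/- STATEMENT 10: Stability. If `|V| = |R × S|`, `K_1` is invertible with inverse `𝒦_1`, and
`D` is a compact subset of `Ω_p = {φ : ‖φ‖_p < r_p}`, then there is `M = M(D, p)` such that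
for all `φ_1, φ_2 ∈ D`, the sums `ψ_1, ψ_2` of the corresponding inverse Born series satisfy
`‖ψ_1 − ψ_2‖_p ≤ M ‖φ_1 − φ_2‖_p`. -/
theorem inverse_born_stability [Nonempty V] [Nonempty R] [Nonempty S]
    (p q : ℝ≥0∞) (hp : 1 ≤ p) (hq : 1 ≤ q) (hpq : 1 / p + 1 / q = 1)
    (α0 : ℝ) (hα0 : 0 < α0) (B : Matrix R V ℂ) (G : Matrix V V ℂ) (C : Matrix V S ℂ)
    (hcard : Fintype.card V = Fintype.card (R × S))
    (K1inv : (R × S → ℂ) → V → ℂ)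
    (hleft : ∀ η : V → ℂ, K1inv (bornK α0 B G C 1 fun _ => η) = η)
    (hright : ∀ φ : R × S → ℂ, bornK α0 B G C 1 (fun _ => K1inv φ) = φ)
    (mu nu Cp rp : ℝ) (hmu : mu = muConst α0 q G) (hnu : nu = nuConst α0 p q B C)
    (hCp : Cp = CpConst p α0 B G C)
    (hrp : rp = Cp / mu * (1 - 2 * nu / Cp * (Real.sqrt (1 + Cp / nu) - 1)))
    (D : Set (R × S → ℂ)) (hD : IsCompact D) (hDsub : D ⊆ {φ | lpNorm p φ < rp}) :
    ∃ M : ℝ, ∀ φ1 ∈ D, ∀ φ2 ∈ D,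
      lpNorm p ((∑' j : ℕ, bornKinv α0 B G C K1inv (j + 1) fun _ => φ1) -
          ∑' j : ℕ, bornKinv α0 B G C K1inv (j + 1) fun _ => φ2) ≤
        M * lpNorm p (φ1 - φ2) := by
  have : Fact (1 ≤ p) := ⟨hp⟩
  rcases D.eq_empty_or_nonempty with rfl | ⟨φ0, hφ0⟩
  · exact ⟨0, by simp⟩
  have hrp0 : 0 < rp := (ibs_nonneg p hp φ0).trans_lt (hDsub hφ0)
  have hmu0 : 0 < mu := by
    refine lt_of_le_of_ne ?_ ?_
    · rw [hmu]
      exact mul_nonneg hα0.le (Real.iSup_nonneg fun v => ibs_nonneg q hq _)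
    · rintro h
      rw [hrp, ← h] at hrp0
      simp at hrp0
  have hnu_nonneg : 0 ≤ nu := by
    rw [hnu]
    exact mul_nonneg (mul_nonneg hα0.le (ibs_nonneg p hp _)) (ibs_nonneg p hp _)
  have hCp0 : 0 < Cp := by
    refine lt_of_le_of_ne ?_ ?_
    · rw [hCp]
      refine Real.sInf_nonneg ?_
      rintro t ⟨η, -, rfl⟩
      exact ibs_nonneg p hp _
    · rintro h
      rw [hrp, ← h] at hrp0
      simp at hrp0
  have hP1 : ∀ η : PiLp p (fun _ : V => ℂ), ibsSeries p α0 B G C 1 (fun _ => η) =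
      WithLp.toLp p (bornK α0 B G C 1 fun _ => WithLp.ofLp η) :=
    fun η => ibsSeries_apply p α0 B G C 1 (fun _ => η)
  obtain ⟨L, hL⟩ : ∃ L : PiLp p (fun _ : V => ℂ) →L[ℂ] PiLp p (fun _ : R × S => ℂ),
      L = continuousMultilinearCurryFin1 ℂ (PiLp p (fun _ : V => ℂ))
        (PiLp p (fun _ : R × S => ℂ)) (ibsSeries p α0 B G C 1) := ⟨_, rfl⟩
  have hLa : ∀ η, L η = WithLp.toLp p (bornK α0 B G C 1 fun _ => WithLp.ofLp η) := by
    intro η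
    rw [← hP1, hL, continuousMultilinearCurryFin1_apply]
    congr 1
  have hinj : Function.Injective L := by
    intro x y hxy
    rw [hLa, hLa] at hxy
    have h1 := congrArg K1inv (WithLp.toLp_injective p hxy)
    rw [hleft, hleft] at h1
    exact WithLp.ofLp_injective p h1
  have hLinv : ∀ y : PiLp p (fun _ : R × S => ℂ),
      L (WithLp.toLp p (K1inv (WithLp.ofLp y))) = y := by
    intro y
    rw [hLa]
    simp only [hright]
  let i : PiLp p (fun _ : V => ℂ) ≃L[ℂ] PiLp p (fun _ : R × S => ℂ) :=
    (LinearEquiv.ofBijective L.toLinearMap ⟨hinj, fun y => ⟨_, hLinv y⟩⟩).toContinuousLinearEquiv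
  have hiL : ∀ x, i x = L x := fun x => rfl
  have hi : ∀ y, i.symm y = WithLp.toLp p (K1inv (WithLp.ofLp y)) := by
    intro y
    rw [ContinuousLinearEquiv.symm_apply_eq, hiL, hLinv]
  have hlow : ∀ η, Cp * ‖η‖ ≤ ‖L η‖ := by
    intro η
    rcases eq_or_ne η 0 with rfl | hη
    · simp
    have hn : 0 < ‖η‖ := norm_pos_iff.2 hη
    have h1 : ‖((‖η‖⁻¹ : ℝ) : ℂ) • η‖ = 1 := by
      rw [norm_smul, Complex.norm_real, norm_inv, norm_norm]
      field_simp
    have h2 : Cp ≤ ‖L (((‖η‖⁻¹ : ℝ) : ℂ) • η)‖ := by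
      rw [hCp]
      refine csInf_le ⟨0, ?_⟩ ⟨WithLp.ofLp (((‖η‖⁻¹ : ℝ) : ℂ) • η), ?_, ?_⟩
      · rintro t ⟨η, -, rfl⟩
        exact ibs_nonneg p hp _
      · rw [ibs_norm, WithLp.toLp_ofLp, h1]
      · rw [ibs_norm, hLa]
    rw [map_smul, norm_smul, Complex.norm_real, norm_inv, norm_norm] at h2
    rwa [inv_mul_eq_div, le_div_iff₀ hn] at h2
  have hPn := ibsSeries_norm p q hq hpq α0 hα0 B G C mu nu hmu hnu hmu0 hnu_nonneg
  have hnu0 : 0 < nu := by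
    refine lt_of_lt_of_le hCp0 ?_
    obtain ⟨η, hη⟩ := exists_ne (0 : PiLp p (fun _ : V => ℂ))
    have hn : 0 < ‖η‖ := norm_pos_iff.2 hη
    have h1 := hlow η
    have h2 : ‖L η‖ ≤ nu * ‖η‖ := by
      refine L.le_of_opNorm_le ?_ η
      rw [hL, LinearIsometryEquiv.norm_map]
      refine (hPn 1).trans (le_of_eq ?_)
      field_simp
    exact le_of_mul_le_mul_right (h1.trans h2) hn
  have hinorm : ‖(i.symm : PiLp p (fun _ : R × S => ℂ) →L[ℂ] PiLp p (fun _ : V => ℂ))‖ ≤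
      1 / Cp := by
    refine ContinuousLinearMap.opNorm_le_bound _ (by positivity) fun y => ?_
    have h1 := hlow (i.symm y)
    rw [← hiL, ContinuousLinearEquiv.apply_symm_apply] at h1
    rw [one_div, inv_mul_eq_div, le_div_iff₀ hCp0, mul_comm]
    exact h1
  have hrad := ibs_radius (ibsSeries p α0 B G C) i mu nu Cp rp hmu0 hnu0 hCp0 hrp0 hrp hPn hinorm
  have hone : ibsSeries p α0 B G C 1 = (continuousMultilinearCurryFin1 ℂ (PiLp p (fun _ : V => ℂ))
        (PiLp p (fun _ : R × S => ℂ))).symm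
      (i : PiLp p (fun _ : V => ℂ) →L[ℂ] PiLp p (fun _ : R × S => ℂ)) := by
    rw [LinearIsometryEquiv.eq_symm_apply, ← hL]
    rfl
  rw [← FormalMultilinearSeries.leftInv_eq_rightInv _ _ _ hone] at hrad
  obtain ⟨Q, hQ⟩ : ∃ Q, Q = (ibsSeries p α0 B G C).leftInv i 0 := ⟨_, rfl⟩
  rw [← hQ] at hrad
  have hsum : ∀ φ : R × S → ℂ, lpNorm p φ < rp →
      (∑' j : ℕ, bornKinv α0 B G C K1inv (j + 1) fun _ => φ) =
        WithLp.ofLp (Q.sum (WithLp.toLp p φ)) := by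
    intro φ hφ
    have hterm : ∀ n, WithLp.ofLp (Q n fun _ => WithLp.toLp p φ) =
        bornKinv α0 B G C K1inv n fun _ => φ := by
      intro n
      rw [hQ, ibs_leftInv p α0 B G C K1inv i hi n (fun _ => WithLp.toLp p φ)]
    have hs : HasSum (fun n => Q n fun _ => WithLp.toLp p φ) (Q.sum (WithLp.toLp p φ)) := by
      refine Q.hasSum (Metric.eball_subset_eball hrad ?_)
      rw [Metric.eball_ofReal]
      simpa [← ibs_norm] using hφ
    have hs2 : HasSum (fun n => bornKinv α0 B G C K1inv n fun _ => φ)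
        (WithLp.ofLp (Q.sum (WithLp.toLp p φ))) := by
      have := (PiLp.continuousLinearEquiv p ℂ (fun _ : V => ℂ)).toContinuousLinearMap.hasSum hs
      have e : (fun n => bornKinv α0 B G C K1inv n fun _ => φ) =
          fun n => WithLp.ofLp (Q n fun _ => WithLp.toLp p φ) := funext fun n => (hterm n).symm
      rw [e]
      exact this
    have h0 : (bornKinv α0 B G C K1inv 0 fun _ => φ) = 0 := by simp [bornKinv]
    rw [← hs2.tsum_eq, hs2.summable.tsum_eq_zero_add, h0, zero_add]
  obtain ⟨K, hK⟩ := ibs_lip Q rp hrp0 hrad (WithLp.toLp p '' D)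
    (hD.image (PiLp.continuous_toLp p _)) (by
      rintro _ ⟨φ, hφ, rfl⟩
      rw [← ibs_norm]
      exact hDsub hφ)
  refine ⟨K, fun φ1 h1 φ2 h2 => ?_⟩
  rw [hsum φ1 (hDsub h1), hsum φ2 (hDsub h2), ibs_norm, ibs_norm]
  have := hK.dist_le_mul _ ⟨φ1, h1, rfl⟩ _ ⟨φ2, h2, rfl⟩
  rw [dist_eq_norm, dist_eq_norm] at this
  exact this
end

section
/- Suppose |V| = |R × S| and K_1 is invertible. Let N ≥ 1 and 0 < a < 1. Then there exists a constant C_{N,a} < ∞ such that for every η ∈ ℂ^V with μ_p ‖η‖_{ℓ^p} < a, setting φ = Σ_{j=1}^∞ K_j(η, …, η), one has ‖η − Σ_{j=1}^N 𝒦_j(φ, …, φ)‖_{ℓ^p} ≤ C_{N,a} · ‖η‖_{ℓ^p}^{N+1}. -/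
open scoped ENNReal

variable {V R S : Type*} [Fintype V] [DecidableEq V] [Fintype R] [Fintype S]

section BornAux

open scoped Matrix.Norms.Operator

lemma lpNorm_nonneg_aux (p : ℝ≥0∞) {ι : Type*} [Fintype ι] (f : ι → ℂ) : 0 ≤ lpNorm p f := by
  unfold lpNorm
  split_ifs
  · exact Real.iSup_nonneg fun i => norm_nonneg _
  · positivity

lemma norm_le_lpNorm_aux (p : ℝ≥0∞) (hp : 1 ≤ p) {ι : Type*} [Fintype ι] (f : ι → ℂ) :
    ‖f‖ ≤ lpNorm p f := by
  refine (pi_norm_le_iff_of_nonneg (lpNorm_nonneg_aux p f)).2 fun i => ?_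
  unfold lpNorm
  split_ifs with h
  · exact le_ciSup (f := fun i => ‖f i‖) (Set.finite_range _).bddAbove i
  · have hp0 : 0 < p.toReal := ENNReal.toReal_pos (by positivity) h
    calc ‖f i‖ = (‖f i‖ ^ p.toReal) ^ (1 / p.toReal) := by
          rw [← Real.rpow_mul (norm_nonneg _), mul_one_div_cancel hp0.ne', Real.rpow_one]
      _ ≤ _ := by
          apply Real.rpow_le_rpow (by positivity) _ (by positivity)
          exact Finset.single_le_sum (f := fun i => ‖f i‖ ^ p.toReal)
            (fun i _ => by positivity) (Finset.mem_univ i)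

lemma lpNorm_le_aux (p : ℝ≥0∞) (hp : 1 ≤ p) (ι : Type*) [Fintype ι] :
    ∃ c : ℝ, 0 ≤ c ∧ ∀ f : ι → ℂ, lpNorm p f ≤ c * ‖f‖ := by
  by_cases h : p = ∞
  · refine ⟨1, zero_le_one, fun f => ?_⟩
    simp only [lpNorm, h, if_true, one_mul]
    exact Real.iSup_le (fun i => norm_le_pi_norm f i) (norm_nonneg _)
  · have hp0 : 0 < p.toReal := ENNReal.toReal_pos (by positivity) h
    refine ⟨(Fintype.card ι : ℝ) ^ (1 / p.toReal), by positivity, fun f => ?_⟩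
    simp only [lpNorm, h, if_false]
    calc (∑ i, ‖f i‖ ^ p.toReal) ^ (1 / p.toReal)
        ≤ (∑ i : ι, ‖f‖ ^ p.toReal) ^ (1 / p.toReal) := by
          apply Real.rpow_le_rpow (by positivity) _ (by positivity)
          exact Finset.sum_le_sum fun i _ =>
            Real.rpow_le_rpow (norm_nonneg _) (norm_le_pi_norm f i) hp0.le
      _ = _ := by
          rw [Finset.sum_const, Finset.card_univ, nsmul_eq_mul,
            Real.mul_rpow (by positivity) (by positivity), ← Real.rpow_mul (norm_nonneg _),
            mul_one_div_cancel hp0.ne', Real.rpow_one]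

lemma lpNorm_one_aux {ι : Type*} [Fintype ι] (f : ι → ℂ) : lpNorm 1 f = ∑ i, ‖f i‖ := by
  simp [lpNorm]

lemma holder_aux (p q : ℝ≥0∞) (hp : 1 ≤ p) (hq : 1 ≤ q) (hpq : 1 / p + 1 / q = 1)
    {ι : Type*} [Fintype ι] (g f : ι → ℂ) :
    ∑ i, ‖g i‖ * ‖f i‖ ≤ lpNorm q g * lpNorm p f := by
  by_cases h1 : p = ∞
  · have : q = 1 := by simpa [h1] using hpq
    subst this
    rw [lpNorm_one_aux, Finset.sum_mul]
    refine Finset.sum_le_sum fun i _ => mul_le_mul_of_nonneg_left ?_ (norm_nonneg _)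
    exact (norm_le_pi_norm f i).trans (norm_le_lpNorm_aux p hp f)
  by_cases h2 : q = ∞
  · have : p = 1 := by simpa [h2] using hpq
    subst this
    rw [lpNorm_one_aux, Finset.mul_sum]
    refine Finset.sum_le_sum fun i _ => mul_le_mul_of_nonneg_right ?_ (norm_nonneg _)
    exact (norm_le_pi_norm g i).trans (norm_le_lpNorm_aux q hq g)
  have hp0 : 0 < p.toReal := ENNReal.toReal_pos (by positivity) h1
  have hq0 : 0 < q.toReal := ENNReal.toReal_pos (by positivity) h2
  have hc : q.toReal.HolderConjugate p.toReal := by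
    refine Real.holderConjugate_iff.2 ?_
    have h3 : q.toReal⁻¹ + p.toReal⁻¹ = 1 := by
      rw [← ENNReal.toReal_inv, ← ENNReal.toReal_inv, ← ENNReal.toReal_add, add_comm q⁻¹]
      · simpa using congrArg ENNReal.toReal hpq
      · simp; rintro rfl; simp at hq
      · simp; rintro rfl; simp at hp
    refine ⟨?_, h3⟩
    have : q.toReal⁻¹ < 1 := by have := inv_pos.2 hp0; linarith
    exact (inv_lt_one₀ hq0).1 this
  have := Real.inner_le_Lp_mul_Lq Finset.univ (fun i => ‖g i‖) (fun i => ‖f i‖) hc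
  simpa [lpNorm, h1, h2] using this

/-- `η ↦ -α0 D_η`. -/
noncomputable def bornL0 (V : Type*) [Fintype V] [DecidableEq V] (α0 : ℝ) :
    (V → ℂ) →L[ℂ] Matrix V V ℂ :=
  LinearMap.toContinuousLinearMap ((-(α0 : ℂ)) • Matrix.diagonalLinearMap V ℂ ℂ)

/-- `η ↦ -α0 G D_η`. -/
noncomputable def bornL1 (α0 : ℝ) (G : Matrix V V ℂ) : (V → ℂ) →L[ℂ] Matrix V V ℂ :=
  LinearMap.toContinuousLinearMap
    ((-(α0 : ℂ)) • (LinearMap.mulLeft ℂ G ∘ₗ Matrix.diagonalLinearMap V ℂ ℂ))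

/-- `M ↦ B M C`. -/
noncomputable def bornOuter (B : Matrix R V ℂ) (C : Matrix V S ℂ) :
    Matrix V V ℂ →L[ℂ] (R × S → ℂ) :=
  LinearMap.toContinuousLinearMap
    { toFun := fun M rs => (B * M * C) rs.1 rs.2
      map_add' := fun M M' => by ext; simp [Matrix.mul_add, Matrix.add_mul]
      map_smul' := fun c M => by ext; simp }

/-- Slots of the multilinear map. -/
noncomputable def bornSlot (α0 : ℝ) (G : Matrix V V ℂ) (j : ℕ) :
    Fin (j + 1) → ((V → ℂ) →L[ℂ] Matrix V V ℂ) :=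
  Fin.cons (bornL0 V α0) (fun _ => bornL1 α0 G)

/-- The Born series as a formal multilinear series. -/
noncomputable def bornSer (α0 : ℝ) (B : Matrix R V ℂ) (G : Matrix V V ℂ) (C : Matrix V S ℂ) :
    FormalMultilinearSeries ℂ (V → ℂ) (R × S → ℂ)
  | 0 => 0
  | j + 1 => (bornOuter B C).compContinuousMultilinearMap
      ((ContinuousMultilinearMap.mkPiAlgebraFin ℂ (j + 1) (Matrix V V ℂ)).compContinuousLinearMap
        (bornSlot α0 G j))

lemma bornL0_apply (α0 : ℝ) (η : V → ℂ) :
    bornL0 V α0 η = (-(α0 : ℂ)) • Matrix.diagonal η := rfl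

lemma bornL1_apply (α0 : ℝ) (G : Matrix V V ℂ) (η : V → ℂ) :
    bornL1 α0 G η = (-(α0 : ℂ)) • (G * Matrix.diagonal η) := rfl

lemma bornOuter_apply (B : Matrix R V ℂ) (C : Matrix V S ℂ) (M : Matrix V V ℂ) (rs : R × S) :
    bornOuter B C M rs = (B * M * C) rs.1 rs.2 := rfl

lemma ofFn_smul_prod {A : Type*} [Ring A] [Algebra ℂ A] (c : ℂ) (n : ℕ) (f : Fin n → A) :
    (List.ofFn fun i => c • f i).prod = c ^ n • (List.ofFn f).prod := by
  induction n with
  | zero => simp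
  | succ n ih =>
    rw [List.ofFn_succ, List.ofFn_succ, List.prod_cons, List.prod_cons, ih,
      smul_mul_smul_comm, pow_succ']

lemma bornSer_succ_apply (α0 : ℝ) (B : Matrix R V ℂ) (G : Matrix V V ℂ) (C : Matrix V S ℂ)
    (j : ℕ) (v : Fin (j + 1) → V → ℂ) :
    bornSer α0 B G C (j + 1) v =
      bornOuter B C (bornL0 V α0 (v 0) * (List.ofFn fun i : Fin j => bornL1 α0 G (v i.succ)).prod) := by
  simp [bornSer, bornSlot, List.ofFn_succ]

lemma bornSer_apply (α0 : ℝ) (B : Matrix R V ℂ) (G : Matrix V V ℂ) (C : Matrix V S ℂ)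
    (j : ℕ) (x : ℕ → V → ℂ) :
    bornSer α0 B G C j (fun i => x i) = bornK α0 B G C j x := by
  cases j with
  | zero => rfl
  | succ j =>
    rw [bornSer_succ_apply]
    ext rs
    simp only [bornL1_apply, bornL0_apply, ofFn_smul_prod, bornOuter_apply, bornK]
    rw [smul_mul_smul_comm, ← pow_succ', Matrix.mul_smul, Matrix.smul_mul, Matrix.smul_apply,
      smul_eq_mul]
    simp [Matrix.mul_assoc]

lemma bornL1_norm_le (p q : ℝ≥0∞) (hp : 1 ≤ p) (hq : 1 ≤ q) (hpq : 1 / p + 1 / q = 1)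
    (α0 : ℝ) (hα0 : 0 < α0) (G : Matrix V V ℂ) (η : V → ℂ) :
    ‖bornL1 α0 G η‖ ≤ muConst α0 q G * lpNorm p η := by
  have h0 : 0 ≤ muConst α0 q G :=
    mul_nonneg hα0.le (Real.iSup_nonneg fun v => lpNorm_nonneg_aux q _)
  have h1 : 0 ≤ muConst α0 q G * lpNorm p η := mul_nonneg h0 (lpNorm_nonneg_aux p η)
  have key : ∀ v, ∑ w, ‖bornL1 α0 G η v w‖ ≤ muConst α0 q G * lpNorm p η := by
    intro v
    have : ∀ w, ‖bornL1 α0 G η v w‖ = α0 * (‖G v w‖ * ‖η w‖) := by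
      intro w
      simp [bornL1_apply, abs_of_pos hα0]
    simp only [this]
    rw [← Finset.mul_sum, muConst, mul_assoc]
    refine mul_le_mul_of_nonneg_left ?_ hα0.le
    refine (holder_aux p q hp hq hpq (G v) η).trans ?_
    refine mul_le_mul_of_nonneg_right ?_ (lpNorm_nonneg_aux p η)
    exact le_ciSup (f := fun v => lpNorm q (G v)) (Set.finite_range _).bddAbove v
  rw [Matrix.linfty_opNorm_def]
  lift muConst α0 q G * lpNorm p η to NNReal using h1 with m
  rw [NNReal.coe_le_coe]
  refine Finset.sup_le fun v _ => ?_
  rw [← NNReal.coe_le_coe]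
  push_cast
  exact key v

lemma linear_bound_aux {E F : Type*} [NormedAddCommGroup E] [NormedSpace ℂ E]
    [FiniteDimensional ℂ E] [NormedAddCommGroup F] [NormedSpace ℂ F] (f : E →ₗ[ℂ] F) :
    ∃ K : ℝ, 0 < K ∧ ∀ x, ‖f x‖ ≤ K * ‖x‖ :=
  (LinearMap.toContinuousLinearMap f).bound

lemma bornOuter_bound (B : Matrix R V ℂ) (C : Matrix V S ℂ) :
    ∃ K : ℝ, 0 < K ∧ ∀ M, ‖bornOuter B C M‖ ≤ K * ‖M‖ :=
  linear_bound_aux (bornOuter B C).toLinearMap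

lemma bornL0_bound (V : Type*) [Fintype V] [DecidableEq V] (α0 : ℝ) :
    ∃ K : ℝ, 0 < K ∧ ∀ η, ‖bornL0 V α0 η‖ ≤ K * ‖η‖ :=
  linear_bound_aux (bornL0 V α0).toLinearMap

lemma bornL1_bound (α0 : ℝ) (G : Matrix V V ℂ) :
    ∃ K : ℝ, 0 < K ∧ ∀ η, ‖bornL1 α0 G η‖ ≤ K * ‖η‖ :=
  linear_bound_aux (bornL1 α0 G).toLinearMap

lemma ofFn_norm_le' {A : Type*} [NormedRing A] (j : ℕ) (x : A) (y : Fin j → A) :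
    ‖x * (List.ofFn y).prod‖ ≤ ‖x‖ * ∏ i, ‖y i‖ := by
  induction j generalizing x with
  | zero => simp
  | succ j ih =>
    rw [List.ofFn_succ, List.prod_cons, ← mul_assoc, Fin.prod_univ_succ, ← mul_assoc]
    refine (ih (x * y 0) _).trans ?_
    exact mul_le_mul_of_nonneg_right (norm_mul_le _ _) (by positivity)

lemma bornSer_diag_norm_le (α0 : ℝ) (B : Matrix R V ℂ) (G : Matrix V V ℂ) (C : Matrix V S ℂ) :
    ∃ K : ℝ, 0 < K ∧ ∀ (j : ℕ) (η : V → ℂ), ‖bornSer α0 B G C (j + 1) fun _ => η‖ ≤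
      K * ‖η‖ * ‖bornL1 α0 G η‖ ^ j := by
  obtain ⟨K, hK, h⟩ := bornOuter_bound B C
  obtain ⟨K0, hK0, h0⟩ := bornL0_bound V α0
  refine ⟨K * K0, by positivity, fun j η => ?_⟩
  rw [bornSer_succ_apply]
  refine (h _).trans ?_
  rw [mul_assoc, mul_assoc, ← mul_assoc K0]
  refine mul_le_mul_of_nonneg_left ((ofFn_norm_le' _ _ _).trans ?_) hK.le
  simp only [Finset.prod_const, Finset.card_univ, Fintype.card_fin]
  exact mul_le_mul_of_nonneg_right (h0 η) (by positivity)

lemma bornSer_norm_le (α0 : ℝ) (B : Matrix R V ℂ) (G : Matrix V V ℂ) (C : Matrix V S ℂ) :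
    ∃ K Λ : ℝ, 0 < Λ ∧ ∀ n, ‖bornSer α0 B G C n‖ ≤ K * Λ ^ n := by
  obtain ⟨K, hK, h⟩ := bornOuter_bound B C
  obtain ⟨K0, hK0, h0⟩ := bornL0_bound V α0
  obtain ⟨K1, hK1, h1⟩ := bornL1_bound α0 G
  refine ⟨K * K0 / K1, K1, hK1, fun n => ?_⟩
  cases n with
  | zero => simp [bornSer]; positivity
  | succ j =>
    refine ContinuousMultilinearMap.opNorm_le_bound (by positivity) fun v => ?_
    rw [bornSer_succ_apply]
    calc _ ≤ K * (‖bornL0 V α0 (v 0)‖ * ∏ i : Fin j, ‖bornL1 α0 G (v i.succ)‖) :=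
          (h _).trans (mul_le_mul_of_nonneg_left (ofFn_norm_le' _ _ _) hK.le)
      _ ≤ K * ((K0 * ‖v 0‖) * ∏ i : Fin j, (K1 * ‖v i.succ‖)) := by
          gcongr
          · exact h0 _
          · exact h1 _
      _ = _ := by
          rw [Fin.prod_univ_succ, Finset.prod_mul_distrib]
          simp only [Finset.prod_const, Finset.card_univ, Fintype.card_fin]
          field_simp
          ring

lemma bornSer_radius_pos (α0 : ℝ) (B : Matrix R V ℂ) (G : Matrix V V ℂ) (C : Matrix V S ℂ) :
    0 < (bornSer α0 B G C).radius := by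
  obtain ⟨K, Λ, hΛ, h⟩ := bornSer_norm_le α0 B G C
  have : ((Λ⁻¹.toNNReal : NNReal) : ℝ≥0∞) ≤ (bornSer α0 B G C).radius := by
    refine FormalMultilinearSeries.le_radius_of_bound _ K fun n => ?_
    refine (mul_le_mul_of_nonneg_right (h n) (by positivity)).trans_eq ?_
    rw [Real.coe_toNNReal _ (by positivity)]
    rw [mul_assoc, ← mul_pow, mul_inv_cancel₀ hΛ.ne', one_pow, mul_one]
  refine lt_of_lt_of_le ?_ this
  rw [ENNReal.coe_pos, Real.toNNReal_pos]
  exact inv_pos.2 hΛ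

lemma bornKinv_eq_leftInv (α0 : ℝ) (B : Matrix R V ℂ) (G : Matrix V V ℂ) (C : Matrix V S ℂ)
    (K1inv : (R × S → ℂ) → V → ℂ) (e : (V → ℂ) ≃L[ℂ] (R × S → ℂ)) (he : ∀ φ, e.symm φ = K1inv φ)
    (n : ℕ) (x : ℕ → R × S → ℂ) :
    (bornSer α0 B G C).leftInv e 0 n (fun i => x i) = bornKinv α0 B G C K1inv n x := by
  induction n using Nat.strong_induction_on generalizing x with
  | _ n ih =>
  match n with
  | 0 => simp [bornKinv]
  | 1 => simp [bornKinv, he]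
  | n + 2 =>
    rw [FormalMultilinearSeries.leftInv, bornKinv]
    simp only [_root_.neg_apply, _root_.sum_apply]
    congr 1
    rw [← Finset.sum_filter_add_sum_filter_not Finset.univ
      (fun c : Composition (n + 2) => c.length < n + 2)]
    rw [Finset.sum_eq_zero (s := Finset.univ.filter
      (fun c : Composition (n + 2) => ¬ c.length < n + 2)), add_zero]
    · rw [Finset.sum_subtype (p := fun c : Composition (n + 2) => c.length < n + 2)
        (F := inferInstance) _ (by simp)]
      refine Finset.sum_congr rfl fun c _ => ?_
      rw [dif_pos c.2, ← ih _ c.2]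
      rw [ContinuousMultilinearMap.compAlongComposition_apply]
      congr 1
      ext1 k
      rw [blockK, dif_pos k.2, ← bornSer_apply]
      simp only [FormalMultilinearSeries.applyComposition]
      rw [FormalMultilinearSeries.compContinuousLinearMap_apply]
      congr 1
      ext1 i
      simp [he]
    · intro c hc
      rw [dif_neg (by simpa using hc)]

/-- Local (near the origin) error bound, for a general series. -/
lemma local_bound_aux {E F : Type*} [NormedAddCommGroup E] [NormedSpace ℂ E]
    [NormedAddCommGroup F] [NormedSpace ℂ F] [CompleteSpace E] [CompleteSpace F]
    (P : FormalMultilinearSeries ℂ E F) (hP : 0 < P.radius) (h0 : P 0 = 0)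
    (e : E ≃L[ℂ] F) (he : P 1 = (continuousMultilinearCurryFin1 ℂ E F).symm e)
    (N : ℕ) (hN : 1 ≤ N) :
    (fun η : E => η - ∑ j ∈ Finset.range N, P.leftInv e 0 (j + 1) fun _ => P.sum η)
      =O[nhds 0] fun η => ‖η‖ ^ (N + 1) := by
  set T : FormalMultilinearSeries ℂ F E := fun n => if n ≤ N then P.leftInv e 0 n else 0 with hT
  have hTr : T.radius = ∞ := by
    refine FormalMultilinearSeries.radius_eq_top_of_forall_image_add_eq_zero _ (N + 1) fun m => ?_
    simp only [hT]
    rw [if_neg (by omega)]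
  have hTs : ∀ y, T.sum y = ∑ j ∈ Finset.range N, P.leftInv e 0 (j + 1) fun _ => y := by
    intro y
    rw [FormalMultilinearSeries.sum, tsum_eq_sum (s := Finset.range (N + 1)),
      Finset.sum_range_succ']
    · have : T 0 (fun _ => y) = 0 := by simp [hT]
      rw [this, add_zero]
      refine Finset.sum_congr rfl fun j hj => ?_
      have : j + 1 ≤ N := by simpa using hj
      simp only [hT]
      rw [if_pos this]
    · intro b hb
      have : ¬ b ≤ N := by simpa [Nat.lt_succ_iff] using hb
      simp only [hT]
      rw [if_neg this]; simp
  have hP0 : P.sum 0 = 0 := by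
    rw [FormalMultilinearSeries.sum]
    refine (tsum_congr fun n => ?_).trans tsum_zero
    cases n with
    | zero => simp [h0]
    | succ n => exact (P (n + 1)).map_coord_zero 0 rfl
  have hf : HasFPowerSeriesAt P.sum P 0 := (P.hasFPowerSeriesOnBall hP).hasFPowerSeriesAt
  have hg : HasFPowerSeriesAt T.sum T (P.sum 0) := by
    rw [hP0]
    exact (T.hasFPowerSeriesOnBall (by rw [hTr]; simp)).hasFPowerSeriesAt
  have hc := (hg.comp hf).isBigO_sub_partialSum_pow (N + 1)
  have hps : ∀ y, (T.comp P).partialSum (N + 1) y = y := by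
    intro y
    have h1 : ∀ k ∈ Finset.range (N + 1), (T.comp P) k (fun _ => y)
        = FormalMultilinearSeries.id ℂ E 0 k fun _ => y := by
      intro k hk
      rw [← P.leftInv_comp e 0 he]
      simp only [FormalMultilinearSeries.comp, _root_.sum_apply,
        FormalMultilinearSeries.compAlongComposition_apply]
      refine Finset.sum_congr rfl fun c _ => ?_
      have : c.length ≤ N := c.length_le.trans (by simpa [Nat.lt_succ_iff] using hk)
      simp only [hT]
      rw [if_pos this]
    rw [FormalMultilinearSeries.partialSum, Finset.sum_congr rfl h1,
      Finset.sum_eq_single_of_mem 1 (by simp; omega)]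
    · simp
    · intro b _ hb
      rcases Nat.lt_or_gt_of_ne hb with hb | hb
      · obtain rfl : b = 0 := by omega
        simp
      · rw [FormalMultilinearSeries.id_apply_of_one_lt _ _ _ hb]; simp
  refine hc.neg_left.congr_left fun y => ?_
  rw [hps, zero_add, neg_sub, Function.comp, hTs]

/-- The case `G = 0`. -/
lemma linear_case_aux {E F : Type*} [NormedAddCommGroup E] [NormedSpace ℂ E]
    [NormedAddCommGroup F] [NormedSpace ℂ F]
    (P : FormalMultilinearSeries ℂ E F)
    (e : E ≃L[ℂ] F) (hP : ∀ n, 2 ≤ n → P n = 0) (n : ℕ) (hn : 2 ≤ n) :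
    P.leftInv e 0 n = 0 := by
  obtain ⟨m, rfl⟩ : ∃ m, n = m + 2 := ⟨n - 2, by omega⟩
  rw [FormalMultilinearSeries.leftInv]
  rw [Finset.sum_eq_zero, neg_zero]
  rintro ⟨c, hc⟩ _
  ext v
  rw [ContinuousMultilinearMap.compAlongComposition_apply]
  have hne : c ≠ Composition.ones (m + 2) := by
    rintro rfl
    simp at hc
  obtain ⟨i, hi, hi1⟩ := Composition.ne_ones_iff.1 hne
  obtain ⟨k, rfl⟩ : ∃ k, c.blocksFun k = i := by
    rw [← c.ofFn_blocksFun, List.mem_ofFn] at hi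
    exact hi
  rw [_root_.zero_apply]
  refine ContinuousMultilinearMap.map_coord_zero _ k ?_
  simp only [FormalMultilinearSeries.applyComposition]
  rw [FormalMultilinearSeries.compContinuousLinearMap_apply, hP _ hi1]
  rfl

lemma bornSer_diag_norm_le' (p q : ℝ≥0∞) (hp : 1 ≤ p) (hq : 1 ≤ q) (hpq : 1 / p + 1 / q = 1)
    (α0 : ℝ) (hα0 : 0 < α0) (B : Matrix R V ℂ) (G : Matrix V V ℂ) (C : Matrix V S ℂ) :
    ∃ K : ℝ, 0 < K ∧ ∀ (j : ℕ) (η : V → ℂ), ‖bornSer α0 B G C (j + 1) fun _ => η‖ ≤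
      K * ‖η‖ * (muConst α0 q G * lpNorm p η) ^ j := by
  obtain ⟨K, hK, hKb⟩ := bornSer_diag_norm_le α0 B G C
  refine ⟨K, hK, fun j η => (hKb j η).trans ?_⟩
  have h2 := bornL1_norm_le p q hp hq hpq α0 hα0 G η
  gcongr

end BornAux

/- STATEMENT 12: Asymptotic truncation error. If `|V| = |R × S|`, `K_1` is invertible with
inverse `𝒦_1`, `N ≥ 1` and `0 < a < 1`, there is a constant `C_{N,a}` such that for every
`η` with `μ_p ‖η‖_p < a`, setting `φ = Σ_{j=1}^∞ K_j(η, …, η)`,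
`‖η − Σ_{j=1}^N 𝒦_j(φ, …, φ)‖_p ≤ C_{N,a} ‖η‖_p^{N+1}`. -/
theorem inverse_born_asymptotic_error [Nonempty V] [Nonempty R] [Nonempty S]
    (p q : ℝ≥0∞) (hp : 1 ≤ p) (hq : 1 ≤ q) (hpq : 1 / p + 1 / q = 1)
    (α0 : ℝ) (hα0 : 0 < α0) (B : Matrix R V ℂ) (G : Matrix V V ℂ) (C : Matrix V S ℂ)
    (hcard : Fintype.card V = Fintype.card (R × S))
    (K1inv : (R × S → ℂ) → V → ℂ)
    (hleft : ∀ η : V → ℂ, K1inv (bornK α0 B G C 1 fun _ => η) = η)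
    (hright : ∀ φ : R × S → ℂ, bornK α0 B G C 1 (fun _ => K1inv φ) = φ)
    (N : ℕ) (hN : 1 ≤ N) (a : ℝ) (ha0 : 0 < a) (ha1 : a < 1) :
    ∃ CNa : ℝ, ∀ η : V → ℂ, muConst α0 q G * lpNorm p η < a →
      lpNorm p (η - ∑ j ∈ Finset.range N, bornKinv α0 B G C K1inv (j + 1) fun _ =>
          ∑' i : ℕ, bornK α0 B G C (i + 1) fun _ => η) ≤
        CNa * lpNorm p η ^ (N + 1) := by

  have hnu : 0 ≤ muConst α0 q G :=
    mul_nonneg hα0.le (Real.iSup_nonneg fun v => lpNorm_nonneg_aux q _)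
  set P := bornSer α0 B G C with hPdef
  have hPK : ∀ n (η : V → ℂ), bornK α0 B G C n (fun _ => η) = P n fun _ => η :=
    fun n η => (bornSer_apply α0 B G C n fun _ => η).symm
  -- the linear part as an equivalence
  let k1 : (V → ℂ) →L[ℂ] (R × S → ℂ) := continuousMultilinearCurryFin1 ℂ (V → ℂ) (R × S → ℂ) (P 1)
  have hk1 : ∀ η, k1 η = bornK α0 B G C 1 fun _ => η := by
    intro η
    rw [hPK]
    simp only [k1, continuousMultilinearCurryFin1_apply]
    congr 1
  let e : (V → ℂ) ≃L[ℂ] (R × S → ℂ) :=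
    ({ k1.toLinearMap with
        invFun := K1inv
        left_inv := fun η => by
          change K1inv (k1 η) = η
          rw [hk1, hleft]
        right_inv := fun φ => by
          change k1 (K1inv φ) = φ
          rw [hk1, hright] } : (V → ℂ) ≃ₗ[ℂ] (R × S → ℂ)).toContinuousLinearEquiv
  have hes : ∀ φ, e.symm φ = K1inv φ := fun φ => rfl
  have he1 : P 1 = (continuousMultilinearCurryFin1 ℂ (V → ℂ) (R × S → ℂ)).symm e := by
    rw [LinearIsometryEquiv.eq_symm_apply]
    rfl
  have hsum : ∀ η : V → ℂ, (∑' i : ℕ, bornK α0 B G C (i + 1) fun _ => η) = P.sum η := by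
    intro η
    simp only [hPK]
    refine Function.Injective.tsum_eq (f := fun n => P n fun _ => η) (g := fun i : ℕ => i + 1)
      (add_left_injective 1) ?_
    intro n hn
    cases n with
    | zero => exact absurd rfl hn
    | succ n => exact ⟨n, rfl⟩
  have hKinv : ∀ n φ, (bornKinv α0 B G C K1inv n fun _ => φ) = P.leftInv e 0 n fun _ => φ :=
    fun n φ => (bornKinv_eq_leftInv α0 B G C K1inv e hes n fun _ => φ).symm
  simp only [hsum, hKinv]
  rcases hnu.eq_or_lt with hmu | hmu
  · -- `G = 0`
    have hG : ∀ v w, G v w = 0 := by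
      intro v w
      have h1 : (⨆ v : V, lpNorm q (G v)) = 0 := by
        rcases mul_eq_zero.1 hmu.symm with h | h
        · exact absurd h hα0.ne'
        · exact h
      have h2 : ‖G v w‖ ≤ 0 := by
        rw [← h1]
        exact ((norm_le_pi_norm (G v) w).trans (norm_le_lpNorm_aux q hq _)).trans
          (le_ciSup (f := fun v => lpNorm q (G v)) (Set.finite_range _).bddAbove v)
      exact norm_le_zero_iff.1 h2
    have hG0 : G = 0 := by ext v w; exact hG v w
    have hP2 : ∀ n, 2 ≤ n → P n = 0 := by
      intro n hn
      obtain ⟨m, rfl⟩ : ∃ m, n = m + 1 + 1 := ⟨n - 2, by omega⟩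
      ext1 v
      rw [hPdef, bornSer_succ_apply, List.ofFn_succ, List.prod_cons, bornL1_apply, hG0]
      simp
    refine ⟨0, fun η _ => ?_⟩
    have hs : P.sum η = e η := by
      rw [FormalMultilinearSeries.sum, tsum_eq_single 1, he1]
      · simp
      · intro n hn
        rcases Nat.lt_or_gt_of_ne hn with hn | hn
        · obtain rfl : n = 0 := by omega
          rfl
        · rw [hP2 n hn]; simp
    have hz : η - ∑ j ∈ Finset.range N, (P.leftInv e 0 (j + 1) fun _ => P.sum η) = 0 := by
      rw [Finset.sum_eq_single_of_mem 0 (by simp; omega)]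
      · simp [hs]
      · intro b _ hb
        rw [linear_case_aux P e hP2 (b + 1) (by omega)]; simp
    rw [hz]
    obtain ⟨c, hc, h⟩ := lpNorm_le_aux p hp V
    simpa using h 0
  · obtain ⟨c, hc, hcb⟩ := lpNorm_le_aux p hp V
    obtain ⟨K, hK, hKb⟩ := bornSer_diag_norm_le' p q hp hq hpq α0 hα0 B G C
    obtain ⟨C1, hC1, hloc⟩ := (local_bound_aux P (bornSer_radius_pos α0 B G C) rfl e he1 N
      hN).exists_pos
    rw [Asymptotics.IsBigOWith, Metric.eventually_nhds_iff] at hloc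
    obtain ⟨δ, hδ, hloc⟩ := hloc
    have hle : ∀ η : V → ℂ, muConst α0 q G * lpNorm p η < a →
        ‖η‖ ≤ a / muConst α0 q G := by
      intro η hη
      rw [le_div_iff₀ hmu, mul_comm]
      exact (mul_le_mul_of_nonneg_left (norm_le_lpNorm_aux p hp η) hnu).trans hη.le
    set M1 := a / muConst α0 q G with hM1
    have hM1' : 0 ≤ M1 := by positivity
    have hφ : ∀ η : V → ℂ, muConst α0 q G * lpNorm p η < a →
        ‖P.sum η‖ ≤ K * M1 * (1 - a)⁻¹ := by
      intro η hη
      rw [← hsum]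
      have hg := (hasSum_geometric_of_lt_one ha0.le ha1).mul_left (K * M1)
      refine tsum_of_norm_bounded hg fun i => ?_
      rw [hPK]
      refine (hKb i η).trans ?_
      have h1 := hle η hη
      have h2 : 0 ≤ muConst α0 q G * lpNorm p η := mul_nonneg hnu (lpNorm_nonneg_aux p η)
      gcongr
    obtain ⟨M2, hM2⟩ := (isCompact_closedBall (0 : R × S → ℂ)
      (K * M1 * (1 - a)⁻¹)).exists_bound_of_continuousOn
      (f := fun y => ∑ j ∈ Finset.range N, P.leftInv e 0 (j + 1) fun _ => y)
      (by
        refine Continuous.continuousOn (continuous_finsetSum _ fun j _ => ?_)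
        exact (P.leftInv e 0 (j + 1)).cont.comp (continuous_pi fun _ => continuous_id))
    refine ⟨c * (C1 + (M1 + M2) / δ ^ (N + 1)), fun η hη => ?_⟩
    have hM20 : 0 ≤ M2 := (norm_nonneg _).trans
      (hM2 (P.sum η) (mem_closedBall_zero_iff.2 (hφ η hη)))
    refine (hcb _).trans ?_
    rw [mul_assoc]
    refine mul_le_mul_of_nonneg_left ?_ hc
    have hpow : ‖η‖ ^ (N + 1) ≤ lpNorm p η ^ (N + 1) :=
      pow_le_pow_left₀ (norm_nonneg _) (norm_le_lpNorm_aux p hp η) _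
    refine le_trans ?_ (mul_le_mul_of_nonneg_left hpow (by positivity))
    rw [add_mul]
    by_cases hd : ‖η‖ < δ
    · have := hloc (y := η) (by simpa using hd)
      rw [norm_pow, norm_norm] at this
      have h2 : 0 ≤ (M1 + M2) / δ ^ (N + 1) * ‖η‖ ^ (N + 1) := by positivity
      linarith
    · have h1 : δ ^ (N + 1) ≤ ‖η‖ ^ (N + 1) := pow_le_pow_left₀ hδ.le (not_lt.1 hd) _
      have h2 : M1 + M2 ≤ (M1 + M2) / δ ^ (N + 1) * ‖η‖ ^ (N + 1) := by
        rw [div_mul_eq_mul_div, le_div_iff₀ (by positivity)]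
        exact mul_le_mul_of_nonneg_left h1 (by positivity)
      have h3 := norm_sub_le η (∑ j ∈ Finset.range N, P.leftInv e 0 (j + 1) fun _ => P.sum η)
      have h4 := hM2 (P.sum η) (mem_closedBall_zero_iff.2 (hφ η hη))
      have h5 := hle η hη
      have h6 : 0 ≤ C1 * ‖η‖ ^ (N + 1) := by positivity
      linarith
end
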